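/- arXiv:1603.05331 — 3 statements merged into one kernel-verified Lean document; each statement's English description precedes it below -/
import Mathlib

section
/- Let p and q be real numbers with p > 1 and q > 1. Then the set B = {ε·p^m·q^n : ε ∈ {+1, −1}, m, n ∈ ℤ} is dense in ℝ if and only if (ln p)/(ln q) is irrational. -/
/-- `x` lies in the additive subgroup of `ℝ` generated by `log p` and `log q` iff `exp x` is a
product of integer powers of `p` and `q`. -/
theorem mem_closure_log_pair_iff {p q : ℝ} (hp : 0 < p) (hq : 0 < q) (x : ℝ) :
    x ∈ AddSubgroup.closure {Real.log p, Real.log q} ↔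
      ∃ m n : ℤ, Real.exp x = p ^ m * q ^ n := by
  rw [AddSubgroup.mem_closure_pair]
  refine exists₂_congr fun m n => ?_
  rw [← Real.exp_injective.eq_iff, zsmul_eq_mul, zsmul_eq_mul, Real.exp_add, mul_comm (m : ℝ),
    mul_comm (n : ℝ), ← Real.rpow_def_of_pos hp, ← Real.rpow_def_of_pos hq,
    Real.rpow_intCast, Real.rpow_intCast, eq_comm]

/-- If the additive subgroup generated by `log p` and `log q` is dense, then every nonempty open
interval with positive endpoints contains a product of integer powers of `p` and `q`. -/
theorem exists_zpow_mul_zpow_between {p q : ℝ} (hp : 0 < p) (hq : 0 < q)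
    (h : Dense (AddSubgroup.closure {Real.log p, Real.log q} : Set ℝ)) {a b : ℝ}
    (ha : 0 < a) (hab : a < b) : ∃ m n : ℤ, a < p ^ m * q ^ n ∧ p ^ m * q ^ n < b := by
  obtain ⟨x, hx, hax, hxb⟩ := h.exists_between (Real.log_lt_log ha hab)
  obtain ⟨m, n, hmn⟩ := (mem_closure_log_pair_iff hp hq x).1 hx
  refine ⟨m, n, ?_, ?_⟩ <;> rw [← hmn]
  · exact (Real.log_lt_iff_lt_exp ha).1 hax
  · exact (Real.lt_log_iff_exp_lt (ha.trans hab)).1 hxb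

/-- For `p, q > 1`, the set `B = {±p^m·q^n : m, n ∈ ℤ}` is dense in `ℝ` iff
`(ln p)/(ln q)` is irrational. -/
theorem dense_pm_powers_iff_irrational (p q : ℝ) (hp : 1 < p) (hq : 1 < q) :
    Dense {x : ℝ | ∃ m n : ℤ, x = p ^ m * q ^ n ∨ x = -(p ^ m * q ^ n)} ↔
      Irrational (Real.log p / Real.log q) := by
  have hp0 : 0 < p := one_pos.trans hp
  have hq0 : 0 < q := one_pos.trans hq
  rw [← dense_addSubgroupClosure_pair_iff]
  constructor <;> intro h <;> refine dense_of_exists_between fun {a b} hab => ?_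
  · obtain ⟨x, ⟨m, n, hx⟩, hax, hxb⟩ := h.exists_between (Real.exp_lt_exp.2 hab)
    have hx0 : 0 < x := (Real.exp_pos a).trans hax
    have hpos : 0 < p ^ m * q ^ n := by positivity
    have hx : x = p ^ m * q ^ n := hx.resolve_right (by linarith)
    exact ⟨Real.log x,
      (mem_closure_log_pair_iff hp0 hq0 _).2 ⟨m, n, by rw [Real.exp_log hx0, hx]⟩,
      (Real.lt_log_iff_exp_lt hx0).2 hax, (Real.log_lt_iff_lt_exp hx0).2 hxb⟩
  · rcases lt_or_ge 0 b with hb | hb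
    · obtain ⟨m, n, h₁, h₂⟩ := exists_zpow_mul_zpow_between hp0 hq0 h
        (lt_max_of_lt_right (half_pos hb)) (max_lt hab (half_lt_self hb))
      exact ⟨_, ⟨m, n, Or.inl rfl⟩, (le_max_left _ _).trans_lt h₁, h₂⟩
    · have ha : 0 < -a := by linarith
      obtain ⟨m, n, h₁, h₂⟩ := exists_zpow_mul_zpow_between hp0 hq0 h
        (lt_max_of_lt_right (half_pos ha)) (max_lt (neg_lt_neg hab) (half_lt_self ha))
      exact ⟨_, ⟨m, n, Or.inr rfl⟩, lt_neg_of_lt_neg h₂,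
        neg_lt_of_neg_lt ((le_max_left _ _).trans_lt h₁)⟩
end

section
/- Let f : ℝ → ℝ be locally integrable on ℝ \ {0}, and let p, q be real numbers with p > 1, q > 1 such that (ln p)/(ln q) is irrational. Suppose there exist constants c₁ and c₂ such that for every x ≠ 0, ∫_x^{px} f(t) dt = c₁ and ∫_x^{qx} f(t) dt = c₂. Then there exists a constant c such that f(t) = c/t for almost every t ∈ ℝ \ {0}. -/
open MeasureTheory

/-- A continuous real function whose increments along two incommensurable steps are constant
is affine. -/
lemma Continuous.eq_add_mul_of_const_increments {F : ℝ → ℝ} (hF : Continuous F) {a b c d : ℝ}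
    (ha : a ≠ 0) (hab : Irrational (a / b)) (hFa : ∀ u, F (u + a) = F u + c)
    (hFb : ∀ u, F (u + b) = F u + d) (u : ℝ) : F u = F 0 + c / a * u := by
  set G : ℝ → ℝ := fun u => F u - c / a * u with hG
  have hGc : Continuous G := by fun_prop
  have hGa : Function.Periodic G a := by
    intro u
    simp only [hG, hFa]
    field_simp
    ring
  set e := d - c / a * b with he
  have hGb : ∀ u, G (u + b) = G u + e := by
    intro u
    simp only [hG, hFb, he]
    ring
  have hGn : ∀ n : ℕ, G (n * b) = G 0 + n * e := by
    intro n
    induction n with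
    | zero => simp
    | succ k ih =>
      push_cast
      rw [add_mul, one_mul, hGb, ih]
      ring
  obtain ⟨C, hC⟩ := (hGa.compact_of_continuous ha hGc).isBounded.exists_norm_le
  have hbound : ∀ x, |G x| ≤ C := fun x => hC _ ⟨x, rfl⟩
  have he0 : e = 0 := by
    by_contra hne
    obtain ⟨n, hn⟩ := exists_nat_gt (2 * C / |e|)
    rw [div_lt_iff₀ (abs_pos.2 hne)] at hn
    have h1 : (n : ℝ) * |e| = |G (n * b) - G 0| := by
      rw [hGn, add_sub_cancel_left, abs_mul, Nat.abs_cast]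
    have h2 := abs_sub (G (n * b)) (G 0)
    linarith [hbound (n * b), hbound 0]
  have hper : ∀ g ∈ AddSubgroup.closure {a, b}, Function.Periodic G g := by
    intro g hg
    induction hg using AddSubgroup.closure_induction with
    | mem x hx =>
      rcases hx with rfl | rfl
      · exact hGa
      · intro u
        rw [hGb, he0, add_zero]
    | zero => intro u; simp
    | add x y _ _ hx hy => exact hx.add_period hy
    | neg x _ hx => exact hx.neg
  have hconst : G = fun _ => G 0 :=
    hGc.ext_on (dense_addSubgroupClosure_pair_iff.2 hab) continuous_const fun g hg => by
      simpa using hper g hg 0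
  have := congrFun hconst u
  simp only [hG, mul_zero, sub_zero] at this
  linarith

lemma mul_exp_mem_uIcc (s : ℝ) {u r : ℝ} (hu : |u| ≤ r) :
    s * Real.exp u ∈ Set.uIcc (s * Real.exp (-r)) (s * Real.exp r) := by
  rw [← Set.image_const_mul_uIcc]
  have := abs_le.1 hu
  exact ⟨_, Set.Icc_subset_uIcc ⟨Real.exp_le_exp.2 this.1, Real.exp_le_exp.2 this.2⟩, rfl⟩

lemma MeasureTheory.LocallyIntegrableOn.intervalIntegrable_mul_exp {f : ℝ → ℝ}
    (hf : LocallyIntegrableOn f {(0 : ℝ)}ᶜ volume) {s : ℝ} (hs : s ≠ 0) (u v : ℝ) :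
    IntervalIntegrable f volume (s * Real.exp u) (s * Real.exp v) := by
  refine (hf.integrableOn_compact_subset ?_ isCompact_uIcc).intervalIntegrable
  rw [← Set.image_const_mul_uIcc]
  rintro _ ⟨y, hy, rfl⟩
  have hy0 : 0 < y := (lt_min (Real.exp_pos u) (Real.exp_pos v)).trans_le hy.1
  exact mul_ne_zero hs hy0.ne'

lemma MeasureTheory.LocallyIntegrableOn.continuous_integral_mul_exp {f : ℝ → ℝ}
    (hf : LocallyIntegrableOn f {(0 : ℝ)}ᶜ volume) {s : ℝ} (hs : s ≠ 0) :
    Continuous fun u => ∫ t in s..(s * Real.exp u), f t := by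
  rw [continuous_iff_continuousAt]
  intro u
  set r := |u| + 1 with hr
  have hmem : s ∈ Set.uIcc (s * Real.exp (-r)) (s * Real.exp r) := by
    simpa using mul_exp_mem_uIcc s (u := 0) (r := r) (by rw [abs_zero]; positivity)
  have hcont := intervalIntegral.continuousOn_primitive_interval'
    (hf.intervalIntegrable_mul_exp hs (-r) r) hmem
  have hcomp : ContinuousOn (fun u => ∫ t in s..(s * Real.exp u), f t) (Set.Icc (-r) r) :=
    hcont.comp (f := fun u => s * Real.exp u) (by fun_prop)
      fun v hv => mul_exp_mem_uIcc s (abs_le.2 hv)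
  have hu := abs_lt.1 (lt_add_one |u|)
  exact hcomp.continuousAt (Icc_mem_nhds hu.1 hu.2)

/-- On the half-line of the points having the same sign as `s`, the scaling conditions
determine `f` almost everywhere. -/
lemma ae_eq_div_of_scaling_integrals {f : ℝ → ℝ}
    (hf : LocallyIntegrableOn f {(0 : ℝ)}ᶜ volume) {p q : ℝ} (hp : 1 < p) (hq : 1 < q)
    (hirr : Irrational (Real.log p / Real.log q)) {c₁ c₂ : ℝ}
    (h₁ : ∀ x : ℝ, x ≠ 0 → ∫ t in x..(p * x), f t = c₁)
    (h₂ : ∀ x : ℝ, x ≠ 0 → ∫ t in x..(q * x), f t = c₂) {s : ℝ} (hs : s ≠ 0) :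
    ∀ᵐ t, 0 < t / s → f t = c₁ / Real.log p / t := by
  have step : ∀ {r c : ℝ}, 1 < r → (∀ x : ℝ, x ≠ 0 → ∫ t in x..(r * x), f t = c) → ∀ u,
      ∫ t in s..(s * Real.exp (u + Real.log r)), f t
        = (∫ t in s..(s * Real.exp u), f t) + c := by
    intro r c hr h u
    have hi := hf.intervalIntegrable_mul_exp hs
    have h0 := hi 0 u
    rw [Real.exp_zero, mul_one] at h0
    rw [← h (s * Real.exp u) (mul_ne_zero hs (Real.exp_pos u).ne'),
      ← intervalIntegral.integral_add_adjacent_intervals h0 (hi u (u + Real.log r)),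
      Real.exp_add, Real.exp_log (zero_lt_one.trans hr)]
    ring_nf
  have hF := (hf.continuous_integral_mul_exp hs).eq_add_mul_of_const_increments
    (Real.log_pos hp).ne' hirr (step hp h₁) (step hq h₂)
  simp only [Real.exp_zero, mul_one, intervalIntegral.integral_same, zero_add] at hF
  have hder : ∀ᵐ t, ∀ n : ℕ, t ∈ Set.uIcc (s * Real.exp (-n)) (s * Real.exp n) →
      ∀ c ∈ Set.uIcc (s * Real.exp (-n)) (s * Real.exp n),
        HasDerivAt (fun x => ∫ y in c..x, f y) (f t) t :=
    ae_all_iff.2 fun n =>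
      (hf.intervalIntegrable_mul_exp hs (-n) n).ae_hasDerivAt_integral
  filter_upwards [hder] with t ht hts
  have hexp : ∀ x : ℝ, 0 < x / s → s * Real.exp (Real.log (x / s)) = x := fun x hx => by
    rw [Real.exp_log hx, mul_div_cancel₀ _ hs]
  obtain ⟨n, hn⟩ := exists_nat_ge |Real.log (t / s)|
  have hd := ht n (by simpa only [hexp t hts] using mul_exp_mem_uIcc s hn) s
    (by simpa using mul_exp_mem_uIcc s (u := 0) (r := n) (by simp))
  have hlog : HasDerivAt (fun x => c₁ / Real.log p * Real.log (x / s))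
      (c₁ / Real.log p * (1 / s / (t / s))) t :=
    (((hasDerivAt_id t).div_const s).log hts.ne').const_mul _
  have hev : (fun x => ∫ y in s..x, f y) =ᶠ[nhds t]
      fun x => c₁ / Real.log p * Real.log (x / s) := by
    have hpos : ∀ᶠ x in nhds t, 0 < x / s :=
      (continuous_id.div_const s).continuousAt.eventually (lt_mem_nhds hts)
    filter_upwards [hpos] with x hx
    rw [← hF, hexp x hx]
  rw [hd.unique (hlog.congr_of_eventuallyEq hev), div_div_div_cancel_right₀ hs, mul_one_div]

/-- If `f` is locally integrable on `ℝ \ {0}`, `p, q > 1` with `(ln p)/(ln q)` irrational,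
and the integrals `∫_x^{px} f` and `∫_x^{qx} f` are constant in `x ≠ 0`, then
`f(t) = c/t` for almost every `t ∈ ℝ \ {0}`. -/
theorem eq_const_div_of_scaling_integrals (f : ℝ → ℝ)
    (hf : LocallyIntegrableOn f {(0 : ℝ)}ᶜ volume)
    (p q : ℝ) (hp : 1 < p) (hq : 1 < q)
    (hirr : Irrational (Real.log p / Real.log q))
    (c₁ c₂ : ℝ)
    (h₁ : ∀ x : ℝ, x ≠ 0 → ∫ t in x..(p * x), f t = c₁)
    (h₂ : ∀ x : ℝ, x ≠ 0 → ∫ t in x..(q * x), f t = c₂) :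
    ∃ c : ℝ, ∀ᵐ t ∂(volume.restrict {(0 : ℝ)}ᶜ), f t = c / t := by
  refine ⟨c₁ / Real.log p, (ae_restrict_iff' (measurableSet_singleton 0).compl).2 ?_⟩
  filter_upwards [ae_eq_div_of_scaling_integrals hf hp hq hirr h₁ h₂ one_ne_zero,
    ae_eq_div_of_scaling_integrals hf hp hq hirr h₁ h₂ (neg_ne_zero.2 one_ne_zero)]
    with t hpos hneg ht
  rcases lt_or_gt_of_ne (show t ≠ 0 from ht) with h | h
  · exact hneg (div_pos_of_neg_of_neg h (by norm_num))
  · exact hpos (by simpa using h)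
end

section
/- Let f : ℝ → ℝ be locally integrable on (0, ∞), and let p, q be real numbers with p > 1, q > 1 such that (ln p)/(ln q) is irrational. Suppose there exist constants c₁ and c₂ such that ∫_x^{px} f(t) dt = c₁ and ∫_x^{qx} f(t) dt = c₂ for every x > 0. Then for every a > 0 and all 0 < x ≤ y, ∫_{ax}^{ay} f(t) dt = ∫_x^y f(t) dt. -/
open MeasureTheory

/-- A continuous real function with two periods of irrational ratio is constant. -/
theorem eq_of_continuous_of_periodic_of_irrational {H : ℝ → ℝ} (hH : Continuous H) {a b : ℝ}
    (hab : Irrational (a / b)) (ha : Function.Periodic H a) (hb : Function.Periodic H b)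
    (s t : ℝ) : H s = H t := by
  have hper : ∀ c ∈ AddSubgroup.closure {a, b}, Function.Periodic H c := fun c hc ↦ by
    induction hc using AddSubgroup.closure_induction with
    | mem c hc => rcases hc with rfl | rfl <;> assumption
    | zero => simp [Function.Periodic]
    | add c d _ _ ihc ihd => exact ihc.add_period ihd
    | neg c _ ih => exact ih.neg
  have hconst : H = fun _ ↦ H 0 :=
    hH.ext_on (dense_addSubgroupClosure_pair_iff.2 hab) continuous_const
      fun c hc ↦ by simpa using hper c hc 0
  rw [hconst]

/-- A function locally integrable on `(0, ∞)` is interval integrable between positive points. -/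
theorem intervalIntegrable_of_locallyIntegrableOn_Ioi {f : ℝ → ℝ}
    (hf : LocallyIntegrableOn f (Set.Ioi (0 : ℝ)) volume) {x y : ℝ} (hx : 0 < x) (hy : 0 < y) :
    IntervalIntegrable f volume x y :=
  (hf.integrableOn_compact_subset (fun _ ht ↦ (lt_min hx hy).trans_le ht.1)
    isCompact_uIcc).intervalIntegrable

/-- The primitive of a function locally integrable on `(0, ∞)`, in logarithmic coordinates,
is continuous. -/
theorem continuous_primitive_exp {f : ℝ → ℝ}
    (hf : LocallyIntegrableOn f (Set.Ioi (0 : ℝ)) volume) :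
    Continuous fun u : ℝ ↦ ∫ t in (1 : ℝ)..Real.exp u, f t := by
  refine continuous_iff_continuousAt.2 fun u ↦ ?_
  have hu := Real.exp_pos u
  set m := min (Real.exp u) 1 / 2 with hm
  have hm0 : 0 < m := by positivity
  have hmu : m < Real.exp u := by linarith [min_le_left (Real.exp u) 1]
  have hm1 : m < 1 := by linarith [min_le_right (Real.exp u) 1]
  have hle : m ≤ Real.exp u + 1 := by linarith
  have hc := intervalIntegral.continuousOn_primitive_interval'
    (intervalIntegrable_of_locallyIntegrableOn_Ioi hf hm0 (add_pos hu one_pos))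
    (a := 1) (by rw [Set.uIcc_of_le hle]; constructor <;> linarith)
  rw [Set.uIcc_of_le hle] at hc
  exact (hc.continuousAt (Icc_mem_nhds hmu (by linarith))).comp
    (f := Real.exp) Real.continuous_exp.continuousAt

/-- If `f` is locally integrable on `(0, ∞)`, `p, q > 1` with `(ln p)/(ln q)` irrational,
and `∫_x^{px} f = c₁`, `∫_x^{qx} f = c₂` for all `x > 0`, then the measure `E ↦ ∫_E f` is
invariant under every positive scaling: `∫_{ax}^{ay} f = ∫_x^y f` for `a > 0`, `0 < x ≤ y`. -/
theorem integral_all_scale_invariant (f : ℝ → ℝ)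
    (hf : LocallyIntegrableOn f (Set.Ioi (0 : ℝ)) volume)
    (p q : ℝ) (hp : 1 < p) (hq : 1 < q)
    (hirr : Irrational (Real.log p / Real.log q))
    (c₁ c₂ : ℝ)
    (h₁ : ∀ x : ℝ, 0 < x → ∫ t in x..(p * x), f t = c₁)
    (h₂ : ∀ x : ℝ, 0 < x → ∫ t in x..(q * x), f t = c₂) :
    ∀ a : ℝ, 0 < a → ∀ x y : ℝ, 0 < x → x ≤ y →
      ∫ t in (a * x)..(a * y), f t = ∫ t in x..y, f t := by
  intro a ha x y hx hxy
  have hy : 0 < y := hx.trans_le hxy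
  set G : ℝ → ℝ := fun u ↦ ∫ t in (1 : ℝ)..Real.exp u, f t with hG
  have hGc : Continuous G := continuous_primitive_exp hf
  have hint {x y : ℝ} (hx : 0 < x) (hy : 0 < y) : IntervalIntegrable f volume x y :=
    intervalIntegrable_of_locallyIntegrableOn_Ioi hf hx hy
  have hshift {r c : ℝ} (hr : 0 < r) (h : ∀ x : ℝ, 0 < x → ∫ t in x..(r * x), f t = c) (u : ℝ) :
      G (u + Real.log r) = G u + c := by
    have hu := Real.exp_pos u
    simp only [hG]
    rw [Real.exp_add, Real.exp_log hr, mul_comm, ← h _ hu,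
      intervalIntegral.integral_add_adjacent_intervals (hint one_pos hu) (hint hu (by positivity))]
  have hper {r c : ℝ} (hr : 0 < r) (h : ∀ x : ℝ, 0 < x → ∫ t in x..(r * x), f t = c) :
      Function.Periodic (fun s ↦ G (s + Real.log y) - G (s + Real.log x)) (Real.log r) := by
    intro s
    simp only [add_right_comm s (Real.log r), hshift hr h]
    ring
  have hval {b : ℝ} (hb : 0 < b) :
      G (Real.log b + Real.log y) - G (Real.log b + Real.log x) = ∫ t in (b * x)..(b * y), f t := by
    simp only [hG]
    rw [Real.exp_add, Real.exp_add, Real.exp_log hb, Real.exp_log hx, Real.exp_log hy]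
    exact intervalIntegral.integral_interval_sub_left (hint one_pos (by positivity))
      (hint one_pos (by positivity))
  have key := eq_of_continuous_of_periodic_of_irrational
    (H := fun s ↦ G (s + Real.log y) - G (s + Real.log x)) (by fun_prop) hirr
    (hper (by linarith) h₁) (hper (by linarith) h₂) (Real.log a) (Real.log 1)
  simpa only [hval ha, hval one_pos, one_mul] using key
end
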